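/- (Column characterization) Let n ≥ 2 and let π₂ be the permutation of {1, …, n²} with π₂((i−1)n + j) = (j−1)n + i for 1 ≤ i, j ≤ n (the transposition of the n×n tableau). Let x = (x₁, …, x_{n²})ᵀ ∈ ℤ^{n²} satisfy 1 ≤ x_i ≤ n for i = 1, …, n². Then A_{π₂} x <> 0 if and only if for each column c = 1, …, n of the x-tableau the set of values {x_c, x_{n+c}, …, x_{(n−1)n+c}} equals {1, …, n}. -/

import Mathlib

open Matrix

/-- The difference matrix `A(n)`: rows are indexed by pairs `(i, j)` with `i < j`,
row `(i, j)` has entry `+1` in column `i`, entry `-1` in column `j`, and `0` elsewhere. -/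
def Amat (n : ℕ) : Matrix {p : Fin n × Fin n // p.1 < p.2} (Fin n) ℤ :=
  fun p k => if k = p.val.1 then 1 else if k = p.val.2 then -1 else 0

/-- The `(n·s(n)) × n²` block-diagonal matrix `A` with `n` copies of `A(n)` along the
diagonal and zeros elsewhere.  Columns are indexed by `Fin (n * n)` in the row-major
layout `(r, j) ↦ r·n + j` given by `finProdFinEquiv`. -/
def bigA (n : ℕ) : Matrix (Fin n × {p : Fin n × Fin n // p.1 < p.2}) (Fin (n * n)) ℤ :=
  fun r c =>
    if (finProdFinEquiv.symm c).1 = r.1 then Amat n r.2 (finProdFinEquiv.symm c).2 else 0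

/-- `A_π`: the matrix `A` with columns permuted by `π`, i.e. the `j`-th column of `A_π`
is the `π⁻¹(j)`-th column of `A`. -/
def Aperm (n : ℕ) (π : Equiv.Perm (Fin (n * n))) :
    Matrix (Fin n × {p : Fin n × Fin n // p.1 < p.2}) (Fin (n * n)) ℤ :=
  (bigA n).submatrix id ⇑π.symm

theorem Amat_mulVec (n : ℕ) (v : Fin n → ℤ) (p : {p : Fin n × Fin n // p.1 < p.2}) :
    (Amat n *ᵥ v) p = v p.val.1 - v p.val.2 := by
  have hcoeff (k : Fin n) : Amat n p k * v k =
      (if k = p.val.1 then v k else 0) - (if k = p.val.2 then v k else 0) := by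
    have := p.2.ne
    unfold Amat
    split_ifs <;> simp_all
  simp only [mulVec, dotProduct, hcoeff]
  simp [Finset.sum_sub_distrib]

theorem Aperm_mulVec (n : ℕ) (π : Equiv.Perm (Fin (n * n))) (x : Fin (n * n) → ℤ) (r : Fin n)
    (p : {p : Fin n × Fin n // p.1 < p.2}) :
    (Aperm n π *ᵥ x) (r, p) = (Amat n *ᵥ fun k => x (π (finProdFinEquiv (r, k)))) p := by
  simp only [mulVec, dotProduct]
  rw [← (finProdFinEquiv.trans π).sum_comp, Fintype.sum_prod_type, Finset.sum_comm]
  simp [Aperm, bigA, ite_mul]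

theorem Amat_mulVec_ne_zero_iff_injective (n : ℕ) (v : Fin n → ℤ) :
    (∀ p, (Amat n *ᵥ v) p ≠ 0) ↔ Function.Injective v := by
  simp only [Amat_mulVec, sub_ne_zero]
  refine ⟨fun h i j hij => ?_, fun h p hp => p.2.ne (h hp)⟩
  by_contra hne
  rcases lt_or_gt_of_ne hne with hlt | hlt
  · exact h ⟨(i, j), hlt⟩ hij
  · exact h ⟨(j, i), hlt⟩ hij.symm

theorem injective_iff_range_eq_Icc (n : ℕ) (v : Fin n → ℤ) (hv : ∀ i, v i ∈ Set.Icc (1 : ℤ) n) :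
    Function.Injective v ↔ Set.range v = Set.Icc (1 : ℤ) n := by
  have hsub : Finset.univ.image v ⊆ Finset.Icc (1 : ℤ) n := by
    intro y hy
    obtain ⟨i, -, rfl⟩ := Finset.mem_image.mp hy
    exact Finset.mem_Icc.mpr (hv i)
  have hcard : (Finset.Icc (1 : ℤ) n).card = (Finset.univ : Finset (Fin n)).card := by simp
  have hcoe : Set.range v = Set.Icc (1 : ℤ) n ↔ Finset.univ.image v = Finset.Icc (1 : ℤ) n := by
    rw [← Finset.coe_inj]
    simp
  rw [hcoe, ← Set.injOn_univ, ← Finset.coe_univ, ← Finset.card_image_iff, ← hcard]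
  exact ⟨fun h => Finset.eq_of_subset_of_card_le hsub h.ge, fun h => by rw [h]⟩

/-- Column characterization: let `π₂` be the permutation transposing the `n × n` tableau,
i.e. `π₂` sends the cell in row `i`, column `j` to the cell in row `j`, column `i`.  For
`x` with `1 ≤ xᵢ ≤ n`, `A_{π₂} x <> 0` holds if and only if each column of the `x`-tableau
consists exactly of the values `1, …, n`. -/
theorem Aperm_transpose_mulVec_ne_zero_iff_cols (n : ℕ) (hn : 2 ≤ n)
    (π₂ : Equiv.Perm (Fin (n * n)))
    (hπ : ∀ i j : Fin n, π₂ (finProdFinEquiv (i, j)) = finProdFinEquiv (j, i))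
    (x : Fin (n * n) → ℤ) (hxb : ∀ i, 1 ≤ x i ∧ x i ≤ (n : ℤ)) :
    (∀ p, (Aperm n π₂ *ᵥ x) p ≠ 0) ↔
      ∀ c : Fin n,
        Set.range (fun i : Fin n => x (finProdFinEquiv (i, c))) = Set.Icc (1 : ℤ) (n : ℤ) := by
  simp only [Prod.forall, Aperm_mulVec, hπ]
  refine forall_congr' fun c => ?_
  rw [← injective_iff_range_eq_Icc n _ fun i => hxb _, ← Amat_mulVec_ne_zero_iff_injective]
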